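/- Let (E,d) be a complete metric space and let d' = min(d, 1), which is a metric on E topologically equivalent to d. A measurable function f : ℝ → E is S⁰-almost periodic (Stepanov almost periodic in Lebesgue measure with respect to d) if and only if f is S^p-almost periodic with respect to the metric d' for every p ≥ 1 (equivalently, for some p ≥ 1). -/

import Mathlib

open MeasureTheory Filter Topology

/-- A set `A ⊆ ℝ` is relatively dense. -/
def RelDense (A : Set ℝ) : Prop := ∃ l > 0, ∀ a : ℝ, ∃ τ ∈ A, τ ∈ Set.Icc a (a + l)

/-- `f` is `S⁰`-almost periodic (Stepanov almost periodic in Lebesgue measure, with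
respect to the metric `d`). -/
def S0AP {E : Type*} [PseudoMetricSpace E] (f : ℝ → E) : Prop :=
  ∀ ε > (0:ℝ), ∀ δ > (0:ℝ), RelDense {τ : ℝ |
    (⨆ ξ : ℝ, volume {t ∈ Set.Icc ξ (ξ + 1) | ε ≤ dist (f (t + τ)) (f t)})
      < ENNReal.ofReal δ}

/-- `f` is `S^p`-almost periodic with respect to the bounded metric `d' = min(d, 1)`. -/
def SpAPmin {E : Type*} [PseudoMetricSpace E] (p : ℝ) (f : ℝ → E) : Prop :=
  ∀ ε > (0:ℝ), RelDense {τ : ℝ | ∀ x : ℝ,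
    (∫ t in x..(x + 1), min (dist (f (t + τ)) (f t)) 1 ^ p) ^ (1 / p) ≤ ε}

section SeparableRange

open Set

/-- In a second countable space, a set whose image under `φ` is uncountable contains two points
with distinct images such that every neighbourhood of either of them in the set has an uncountable
image. -/
theorem exists_pair_forall_nhds_not_countable_image {X Y : Type*} [TopologicalSpace X]
    [SecondCountableTopology X] (φ : X → Y) {C : Set X} (hC : ¬ (φ '' C).Countable) :
    ∃ x y, φ x ≠ φ y ∧ (∀ U ∈ 𝓝 x, ¬ (φ '' (C ∩ U)).Countable) ∧
      ∀ U ∈ 𝓝 y, ¬ (φ '' (C ∩ U)).Countable := by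
  by_contra! H
  set K : Set X := {x | ∀ U ∈ 𝓝 x, ¬ (φ '' (C ∩ U)).Countable} with hK
  have hKsub : (φ '' K).Subsingleton := by
    rintro _ ⟨x, hx, rfl⟩ _ ⟨y, hy, rfl⟩
    by_contra hne
    obtain ⟨U, hU, hUc⟩ := H x y hne hx
    exact hy U hU hUc
  have hloc : ∀ x ∈ C \ K, ∃ U ∈ 𝓝 x, (φ '' (C ∩ U)).Countable := by
    rintro x ⟨-, hx⟩
    simpa [hK] using hx
  choose! U hU hUc using hloc
  obtain ⟨t, ht, htc, hcov⟩ := TopologicalSpace.countable_cover_nhdsWithin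
    (s := C \ K) (f := U) fun x hx => mem_nhdsWithin_of_mem_nhds (hU x hx)
  refine hC ((hKsub.countable.union (htc.biUnion fun x hx => hUc x (ht hx))).mono ?_)
  rintro _ ⟨x, hx, rfl⟩
  by_cases hxK : x ∈ K
  · exact Or.inl ⟨x, hxK, rfl⟩
  · obtain ⟨z, hz, hxz⟩ := mem_iUnion₂.1 (hcov ⟨hx, hxK⟩)
    exact Or.inr (mem_iUnion₂.2 ⟨z, hz, x, ⟨hx, hxz⟩, rfl⟩)

/-- A closed set with uncountable image under a continuous map contains two closed subsets of small
diameter whose images are uncountable and disjoint. -/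
theorem IsClosed.exists_small_diam_disjoint_not_countable_image {X Y : Type*} [MetricSpace X]
    [SecondCountableTopology X] [TopologicalSpace Y] [T2Space Y] {φ : X → Y} (hφ : Continuous φ)
    {C : Set X} (hC : IsClosed C) (hunc : ¬ (φ '' C).Countable) {ε : ENNReal} (hε : 0 < ε) :
    ∃ C₀ C₁ : Set X,
      ((IsClosed C₀ ∧ ¬ (φ '' C₀).Countable) ∧ C₀ ⊆ C ∧ Metric.ediam C₀ ≤ ε) ∧
      ((IsClosed C₁ ∧ ¬ (φ '' C₁).Countable) ∧ C₁ ⊆ C ∧ Metric.ediam C₁ ≤ ε) ∧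
      Disjoint (φ '' C₀) (φ '' C₁) := by
  obtain ⟨x, y, hxy, hx, hy⟩ := exists_pair_forall_nhds_not_countable_image φ hunc
  obtain ⟨V, W, hV, hW, hxV, hyW, hVW⟩ := t2_separation hxy
  have key : ∀ z : X, (∀ U ∈ 𝓝 z, ¬ (φ '' (C ∩ U)).Countable) → ∀ V : Set Y, IsOpen V → φ z ∈ V →
      ∃ D : Set X, ((IsClosed D ∧ ¬ (φ '' D).Countable) ∧ D ⊆ C ∧ Metric.ediam D ≤ ε) ∧
        φ '' D ⊆ V := by
    intro z hz V hV hzV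
    obtain ⟨r, hr, hrV⟩ := Metric.nhds_basis_closedEBall.mem_iff.1
      ((hV.preimage hφ).mem_nhds hzV)
    have hr' : 0 < min r (ε / 2) := lt_min hr (ENNReal.half_pos hε.ne')
    refine ⟨C ∩ Metric.closedEBall z (min r (ε / 2)), ⟨⟨hC.inter Metric.isClosed_closedEBall,
      hz _ (Metric.closedEBall_mem_nhds z hr')⟩, inter_subset_left, ?_⟩, ?_⟩
    · calc Metric.ediam (C ∩ Metric.closedEBall z (min r (ε / 2)))
          ≤ Metric.ediam (Metric.closedEBall z (ε / 2)) :=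
            Metric.ediam_mono (inter_subset_right.trans
              (Metric.closedEBall_subset_closedEBall (min_le_right _ _)))
        _ ≤ 2 * (ε / 2) := Metric.ediam_closedEBall_le
        _ = ε := ENNReal.mul_div_cancel (by simp) (by simp)
    · rw [image_subset_iff]
      exact inter_subset_right.trans
        ((Metric.closedEBall_subset_closedEBall (min_le_left _ _)).trans hrV)
  obtain ⟨C₀, h₀, h₀V⟩ := key x hx V hV hxV
  obtain ⟨C₁, h₁, h₁W⟩ := key y hy W hW hyW
  exact ⟨C₀, C₁, h₀, h₁, hVW.mono h₀V h₁W⟩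

open CantorScheme in
/-- If the range of a continuous map from a Polish space to a Hausdorff space is uncountable, then
the Cantor space injects into it. -/
theorem Continuous.exists_nat_bool_injection_of_not_countable_range {X Y : Type*}
    [TopologicalSpace X] [PolishSpace X] [TopologicalSpace Y] [T2Space Y] {φ : X → Y}
    (hφ : Continuous φ) (hunc : ¬ (range φ).Countable) :
    ∃ i : (ℕ → Bool) → Y, range i ⊆ range φ ∧ Function.Injective i := by
  let := TopologicalSpace.upgradeIsCompletelyMetrizable X
  obtain ⟨u, -, upos', hu⟩ := exists_seq_strictAnti_tendsto' (zero_lt_one' ENNReal)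
  have upos := fun n => (upos' n).1
  let P := Subtype fun C : Set X => IsClosed C ∧ ¬ (φ '' C).Countable
  choose C0 C1 h0 h1 hdisj using fun (C : P) {ε : ENNReal} (hε : 0 < ε) =>
    C.2.1.exists_small_diam_disjoint_not_countable_image hφ C.2.2 hε
  let DP : List Bool → P := fun l => by
    induction l with
    | nil => exact ⟨univ, isClosed_univ, by rwa [image_univ]⟩
    | cons a l ih =>
      cases a
      · exact ⟨C0 ih (upos (l.length + 1)), (h0 _ _).1⟩
      · exact ⟨C1 ih (upos (l.length + 1)), (h1 _ _).1⟩
  let D : List Bool → Set X := fun l => (DP l).val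
  have hanti : ClosureAntitone D := by
    refine Antitone.closureAntitone ?_ fun l => (DP l).property.1
    intro l a
    cases a
    · exact (h0 _ _).2.1
    · exact (h1 _ _).2.1
  have hdiam : VanishingDiam D := by
    intro x
    apply tendsto_of_tendsto_of_tendsto_of_le_of_le' tendsto_const_nhds hu
    · simp
    rw [eventually_atTop]
    refine ⟨1, fun m (hm : 1 ≤ m) => ?_⟩
    rw [Nat.one_le_iff_ne_zero] at hm
    rcases Nat.exists_eq_succ_of_ne_zero hm with ⟨n, rfl⟩
    dsimp
    cases x n
    · convert! (h0 _ _).2.2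
      rw [PiNat.res_length]
    · convert! (h1 _ _).2.2
      rw [PiNat.res_length]
  have hne : ∀ l, (D l).Nonempty := fun l =>
    nonempty_iff_ne_empty.2 fun h => (DP l).property.2 (by
      change (φ '' D l).Countable
      simp [h])
  let A : List Bool → Set Y := fun l => φ '' D l
  have hdisj' : CantorScheme.Disjoint A := by
    rintro l (a | a) (b | b) hab <;> try contradiction
    · exact hdisj _ _
    · exact (hdisj _ _).symm
  have hdom : ∀ x : ℕ → Bool, x ∈ (inducedMap A).1 := fun x => by
    have hx : x ∈ (inducedMap D).1 := by
      rw [hanti.map_of_vanishingDiam hdiam hne]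
      apply mem_univ
    exact ⟨φ ((inducedMap D).2 ⟨x, hx⟩), mem_iInter.2 fun n => ⟨_, map_mem ⟨x, hx⟩ n, rfl⟩⟩
  refine ⟨fun x => (inducedMap A).2 ⟨x, hdom x⟩, ?_, ?_⟩
  · rintro y ⟨x, rfl⟩
    exact image_subset_range _ _ (map_mem ⟨x, hdom x⟩ 0)
  · intro x y hxy
    simpa only [← Subtype.val_inj] using hdisj'.map_injective hxy

open Cardinal in
/-- In a countably generated measurable space there are at most continuum many measurable sets. -/
theorem MeasurableSpace.CountablyGenerated.mk_measurableSet_le_continuum {X : Type*}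
    [m : MeasurableSpace X] [h : MeasurableSpace.CountablyGenerated X] :
    #{s : Set X | MeasurableSet s} ≤ 𝔠 := by
  obtain ⟨b, hb, rfl⟩ := h.isCountablyGenerated
  exact MeasurableSpace.cardinal_measurableSet_le_continuum
    ((le_aleph0_iff_set_countable.2 hb).trans aleph0_le_continuum)

open Cardinal in
/-- A map from a Polish space all of whose preimages are Borel has countable range. -/
theorem countable_range_of_forall_measurableSet_preimage {X Y : Type} [tX : TopologicalSpace X]
    [PolishSpace X] [MeasurableSpace X] [BorelSpace X] [TopologicalSpace Y] [T2Space Y]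
    [SecondCountableTopology Y] {h : X → Y} (hh : ∀ S : Set Y, MeasurableSet (h ⁻¹' S)) :
    (range h).Countable := by
  have hcard := MeasurableSpace.CountablyGenerated.mk_measurableSet_le_continuum (X := X)
  by_contra hunc
  let _ : MeasurableSpace Y := borel Y
  have : BorelSpace Y := ⟨rfl⟩
  have hmeas : Measurable h := fun S _ => hh S
  obtain ⟨t', -, hcont, hpol⟩ := hmeas.exists_continuous
  obtain ⟨i, hi, hinj⟩ :=
    @Continuous.exists_nat_bool_injection_of_not_countable_range X Y t' hpol _ _ h hcont hunc
  have hle : #(Set (ℕ → Bool)) ≤ #{s : Set X | MeasurableSet s} := by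
    refine mk_le_of_injective (f := fun S => ⟨h ⁻¹' (i '' S), hh _⟩) fun S T hST => ?_
    have hpre : h ⁻¹' (i '' S) = h ⁻¹' (i '' T) := congrArg Subtype.val hST
    rw [preimage_eq_preimage' ((image_subset_range i S).trans hi)
      ((image_subset_range i T).trans hi)] at hpre
    exact hinj.image_injective hpre
  have hlt : 𝔠 < #(Set (ℕ → Bool)) := by
    have hc : #(ℕ → Bool) = 𝔠 := by simp
    rw [mk_set, hc]
    exact cantor _
  exact (hlt.trans_le hle).not_ge hcard

/-- A subset of the range of a Borel map on a Polish space which is separated by a positive distance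
is countable. -/
theorem Measurable.countable_of_isSeparated_of_subset_range {X : Type} {E : Type*}
    [TopologicalSpace X] [PolishSpace X] [MeasurableSpace X] [BorelSpace X] [MetricSpace E]
    [MeasurableSpace E] [OpensMeasurableSpace E] {f : X → E} (hf : Measurable f) {ε : NNReal}
    (hε : 0 < ε) {D : Set E} (hD : Metric.IsSeparated ε D) (hDf : D ⊆ range f) : D.Countable := by
  classical
  rcases D.eq_empty_or_nonempty with rfl | ⟨d₀, hd₀⟩
  · exact countable_empty
  have hclosed : ∀ S ⊆ D, IsClosed S := fun S hS =>
    Metric.isClosed_of_pairwise_le_dist (ε := ε) hε fun x hx y hy hxy => by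
      have hlt : (ε : ENNReal) < EDist.edist x y := hD (hS hx) (hS hy) hxy
      rw [edist_nndist] at hlt
      exact NNReal.coe_le_coe.2 (ENNReal.coe_le_coe.1 hlt.le)
  have : Nonempty X := (hDf hd₀).nonempty
  choose! s hs using fun d (hd : d ∈ D) => mem_range.1 (hDf hd)
  let g : E → X := fun e => if e ∈ D then s e else s d₀
  have hg : ∀ S : Set X, MeasurableSet (f ⁻¹' (g ⁻¹' S)) := by
    intro S
    refine hf ?_
    have h₁ := (hclosed (D ∩ s ⁻¹' S) inter_subset_left).measurableSet
    have h₂ := (hclosed D Subset.rfl).measurableSet.compl.inter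
      (MeasurableSet.const (α := E) (s d₀ ∈ S))
    convert h₁.union h₂ using 1
    ext e
    by_cases he : e ∈ D <;> simp [g, he]
  have hcount := countable_range_of_forall_measurableSet_preimage (h := g ∘ f) hg
  refine (hcount.image f).mono ?_
  intro d hd
  refine ⟨s d, ⟨s d, ?_⟩, hs d hd⟩
  simp [g, hs d hd, hd]

/-- A Borel map from a Polish space to a metric space has separable range. -/
theorem Measurable.isSeparable_range_of_polishSpace {X : Type} {E : Type*}
    [TopologicalSpace X] [PolishSpace X] [MeasurableSpace X] [BorelSpace X] [MetricSpace E]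
    [MeasurableSpace E] [OpensMeasurableSpace E] {f : X → E} (hf : Measurable f) :
    TopologicalSpace.IsSeparable (range f) := by
  obtain ⟨t, -, htc, ht⟩ := EMetric.subset_countable_closure_of_almost_dense_set (range f) <| by
    intro ε hε
    obtain ⟨r, hr, hrε⟩ := ENNReal.lt_iff_exists_nnreal_btwn.1 hε
    obtain ⟨N, hN⟩ := zorn_subset {N : Set E | N ⊆ range f ∧ Metric.IsSeparated r N} <| by
      intro c hc hchain
      refine ⟨⋃₀ c, ⟨sUnion_subset fun N hN => (hc hN).1, ?_⟩, fun N hN => subset_sUnion_of_mem hN⟩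
      exact (pairwise_sUnion hchain.directedOn).2 fun N hN => (hc hN).2
    refine ⟨N, hf.countable_of_isSeparated_of_subset_range (by exact_mod_cast hr) hN.prop.2
      hN.prop.1, ?_⟩
    refine (Metric.isCover_iff_subset_iUnion_closedEBall.1
      (Metric.IsCover.of_maximal_isSeparated hN)).trans ?_
    exact iUnion₂_mono fun x _ => Metric.closedEBall_subset_closedEBall hrε.le
  exact ⟨t, htc, ht⟩

/-- A Borel map from a Polish space to a metric space is strongly measurable. -/
theorem Measurable.stronglyMeasurable_of_polishSpace {X : Type} {E : Type*}
    [TopologicalSpace X] [PolishSpace X] [MeasurableSpace X] [BorelSpace X] [MetricSpace E]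
    [MeasurableSpace E] [OpensMeasurableSpace E] {f : X → E} (hf : Measurable f) :
    StronglyMeasurable f := by
  have hsep := hf.isSeparable_range_of_polishSpace
  exact (@stronglyMeasurable_iff_measurable_separable X E f _ _ _ (borel E) (@BorelSpace.mk E _ (borel E) rfl)).2
    ⟨hf.mono le_rfl OpensMeasurableSpace.borel_le, hsep⟩

end SeparableRange

section TruncatedMoments

variable {Ω : Type*} [MeasurableSpace Ω] {μ : Measure Ω} {g : Ω → ℝ}

theorem integrable_min_one_rpow [IsFiniteMeasure μ] (hg : Measurable g) (hg0 : ∀ t, 0 ≤ g t)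
    {p : ℝ} (hp : 0 ≤ p) : Integrable (fun t => min (g t) 1 ^ p) μ := by
  refine Integrable.of_bound ((hg.min measurable_const).pow_const p).aestronglyMeasurable 1
    (ae_of_all _ fun t => ?_)
  have h0 : 0 ≤ min (g t) 1 := le_min (hg0 t) zero_le_one
  rw [Real.norm_of_nonneg (Real.rpow_nonneg h0 p)]
  exact Real.rpow_le_one h0 (min_le_right _ _) hp

theorem integral_min_one_rpow_le [IsProbabilityMeasure μ] (hg : Measurable g)
    (hg0 : ∀ t, 0 ≤ g t) {p : ℝ} (hp : 0 ≤ p) {η : ℝ} (hη : 0 ≤ η) :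
    ∫ t, min (g t) 1 ^ p ∂μ ≤ η ^ p + μ.real {t | η ≤ g t} := by
  have hm : MeasurableSet {t | η ≤ g t} := measurableSet_le measurable_const hg
  have hint : Integrable (Set.indicator {t | η ≤ g t} (1 : Ω → ℝ)) μ :=
    (integrable_const (1 : ℝ)).indicator hm
  calc ∫ t, min (g t) 1 ^ p ∂μ
      ≤ ∫ t, (η ^ p + Set.indicator {t | η ≤ g t} (1 : Ω → ℝ) t) ∂μ := by
        refine integral_mono (integrable_min_one_rpow hg hg0 hp)
          ((integrable_const _).add hint) fun t => ?_
        have h0 : 0 ≤ min (g t) 1 := le_min (hg0 t) zero_le_one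
        by_cases ht : η ≤ g t
        · have h1 := Real.rpow_le_one h0 (min_le_right _ _) hp
          have h2 := Real.rpow_nonneg hη p
          simp only [Set.indicator, Set.mem_ofPred_eq, ht, if_true, Pi.one_apply]
          linarith
        · simpa [Set.indicator, ht] using Real.rpow_le_rpow h0
            ((min_le_left (g t) 1).trans (not_le.1 ht).le) hp
    _ = η ^ p + μ.real {t | η ≤ g t} := by
        rw [integral_add (integrable_const _) hint, integral_indicator_one hm]
        simp

theorem rpow_mul_measureReal_le_integral_min_one_rpow [IsFiniteMeasure μ] (hg : Measurable g)
    (hg0 : ∀ t, 0 ≤ g t) {p : ℝ} (hp : 0 ≤ p) {η : ℝ} (hη : 0 ≤ η) (hη1 : η ≤ 1) :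
    η ^ p * μ.real {t | η ≤ g t} ≤ ∫ t, min (g t) 1 ^ p ∂μ := by
  refine le_trans ?_ (mul_meas_ge_le_integral_of_nonneg
    (ae_of_all _ fun t => Real.rpow_nonneg (le_min (hg0 t) zero_le_one) p)
    (integrable_min_one_rpow hg hg0 hp) (η ^ p))
  refine mul_le_mul_of_nonneg_left (measureReal_mono fun t ht => ?_) (Real.rpow_nonneg hη p)
  exact Real.rpow_le_rpow hη (le_min ht hη1) hp

theorem intervalIntegral_add_one_eq_setIntegral_Icc (φ : ℝ → ℝ) (x : ℝ) :
    ∫ t in x..(x + 1), φ t = ∫ t in Set.Icc x (x + 1), φ t := by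
  rw [intervalIntegral.integral_of_le (by linarith), integral_Icc_eq_integral_Ioc]

theorem isProbabilityMeasure_restrict_Icc_add_one (x : ℝ) :
    IsProbabilityMeasure (volume.restrict (Set.Icc x (x + 1))) :=
  ⟨by simp⟩

theorem restrict_Icc_apply_le {g : ℝ → ℝ} (hg : Measurable g) (η a b : ℝ) :
    volume.restrict (Set.Icc a b) {t | η ≤ g t} = volume {t ∈ Set.Icc a b | η ≤ g t} := by
  rw [Measure.restrict_apply (measurableSet_le measurable_const hg), Set.inter_comm]
  rfl

end TruncatedMoments

theorem RelDense.mono {A B : Set ℝ} (hA : RelDense A) (h : A ⊆ B) : RelDense B := by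
  obtain ⟨l, hl, H⟩ := hA
  refine ⟨l, hl, fun a => ?_⟩
  obtain ⟨τ, hτ, hτa⟩ := H a
  exact ⟨τ, h hτ, hτa⟩

section AlmostPeriodic

variable {E : Type*} [PseudoMetricSpace E] {f : ℝ → E}

theorem S0AP.spAPmin (hm : ∀ τ, Measurable fun t => dist (f (t + τ)) (f t)) (hf : S0AP f) {p : ℝ}
    (hp : 0 < p) : SpAPmin p f := by
  intro ε hε
  have hε' : 0 < ε ^ p / 2 := half_pos (Real.rpow_pos_of_pos hε p)
  have hη : 0 < (ε ^ p / 2) ^ (1 / p) := Real.rpow_pos_of_pos hε' _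
  have hηp : ((ε ^ p / 2) ^ (1 / p)) ^ p = ε ^ p / 2 := by
    rw [← Real.rpow_mul hε'.le, one_div_mul_cancel hp.ne', Real.rpow_one]
  refine (hf _ hη _ hε').mono fun τ hτ x => ?_
  have := isProbabilityMeasure_restrict_Icc_add_one x
  have hbound := integral_min_one_rpow_le (μ := volume.restrict (Set.Icc x (x + 1))) (hm τ)
    (fun _ => dist_nonneg) hp.le hη.le
  have hmeas : (volume.restrict (Set.Icc x (x + 1))).real
      {t | (ε ^ p / 2) ^ (1 / p) ≤ dist (f (t + τ)) (f t)} ≤ ε ^ p / 2 := by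
    rw [measureReal_def, restrict_Icc_apply_le (hm τ)]
    refine ENNReal.toReal_le_of_le_ofReal hε'.le (le_trans ?_ (le_of_lt hτ))
    exact le_iSup (fun ξ : ℝ => volume {t ∈ Set.Icc ξ (ξ + 1) |
      (ε ^ p / 2) ^ (1 / p) ≤ dist (f (t + τ)) (f t)}) x
  rw [intervalIntegral_add_one_eq_setIntegral_Icc, one_div,
    Real.rpow_inv_le_iff_of_pos (integral_nonneg fun t => by positivity) hε.le hp]
  linarith

theorem SpAPmin.s0AP (hm : ∀ τ, Measurable fun t => dist (f (t + τ)) (f t)) {p : ℝ}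
    (hp : 0 < p) (hf : SpAPmin p f) : S0AP f := by
  intro ε hε δ hδ
  have hη : 0 < min ε 1 := lt_min hε one_pos
  have hηp : 0 < min ε 1 ^ p := Real.rpow_pos_of_pos hη p
  have hpos : 0 < min ε 1 ^ p * (δ / 2) := by positivity
  refine (hf ((min ε 1 ^ p * (δ / 2)) ^ p⁻¹) (Real.rpow_pos_of_pos hpos _)).mono fun τ hτ => ?_
  refine lt_of_le_of_lt (iSup_le fun x => ?_)
    ((ENNReal.ofReal_lt_ofReal_iff hδ).2 (half_lt_self hδ))
  have := isProbabilityMeasure_restrict_Icc_add_one x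
  have hx := hτ x
  rw [intervalIntegral_add_one_eq_setIntegral_Icc, one_div, Real.rpow_le_rpow_iff
    (integral_nonneg fun t => by positivity) hpos.le (inv_pos.2 hp)] at hx
  have hmarkov := (rpow_mul_measureReal_le_integral_min_one_rpow
    (μ := volume.restrict (Set.Icc x (x + 1))) (hm τ) (fun _ => dist_nonneg) hp.le hη.le
    (min_le_right _ _)).trans hx
  have hle := le_of_mul_le_mul_left hmarkov hηp
  rw [measureReal_def, restrict_Icc_apply_le (hm τ)] at hle
  refine (measure_mono fun t ht => ?_).trans (ENNReal.le_ofReal_iff_toReal_le ?_ ?_ |>.2 hle)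
  · exact ⟨ht.1, (min_le_left _ _).trans ht.2⟩
  · rw [← restrict_Icc_apply_le (hm τ)]
    exact measure_ne_top _ _
  · positivity

end AlmostPeriodic

/-- a measurable `f : ℝ → E` is `S⁰`-almost periodic (w.r.t. `d`) iff it is
`S^p`-almost periodic with respect to `d' = min(d,1)` for every `p ≥ 1`, equivalently for
some `p ≥ 1`. -/
theorem stmt16 {E : Type*} [MetricSpace E] [CompleteSpace E]
    [MeasurableSpace E] [OpensMeasurableSpace E]
    (f : ℝ → E) (hfm : Measurable f) :
    (S0AP f ↔ ∀ p : ℝ, 1 ≤ p → SpAPmin p f) ∧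
    (S0AP f ↔ ∃ p : ℝ, 1 ≤ p ∧ SpAPmin p f) := by
  have hs := hfm.stronglyMeasurable_of_polishSpace
  have hm : ∀ τ, Measurable fun t => dist (f (t + τ)) (f t) := fun τ =>
    ((hs.comp_measurable (measurable_add_const τ)).dist hs).measurable
  refine ⟨⟨fun h p hp => h.spAPmin hm (by linarith), fun h => (h 1 le_rfl).s0AP hm one_pos⟩,
    ⟨fun h => ⟨1, le_rfl, h.spAPmin hm one_pos⟩, ?_⟩⟩
  rintro ⟨p, hp, h⟩
  exact h.s0AP hm (by linarith)
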